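/- Let K > 0 and g ≥ 0 be real constants, let d be a positive integer, and let f : ℝ × ℝ^d → ℝ be a continuous function satisfying |f(y,z)| ≤ g + K(|y| + |z|) for all (y,z) ∈ ℝ × ℝ^d. Then for every real number n ≥ K, the approximation f_n satisfies the same linear growth bound: |f_n(y,z)| ≤ g + K(|y| + |z|) for all (y,z) ∈ ℝ × ℝ^d. -/

import Mathlib

/-- The inf-convolution approximation
`f_n(y,z) := inf_{(u,v)} { f(u,v) + n(|y − u| + |z − v|) }`. -/
noncomputable def infConv {d : ℕ} (f : ℝ → EuclideanSpace ℝ (Fin d) → ℝ)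
    (n : ℝ) (y : ℝ) (z : EuclideanSpace ℝ (Fin d)) : ℝ :=
  sInf {x : ℝ | ∃ u v, x = f u v + n * (|y - u| + ‖z - v‖)}

/-- the approximation `f_n` satisfies the same linear growth bound
`|f_n(y,z)| ≤ g + K(|y| + |z|)` for every `n ≥ K`. -/
theorem infConv_linear_growth
    {K g : ℝ} (hK : 0 < K) (hg : 0 ≤ g) {d : ℕ} (hd : 0 < d)
    (f : ℝ → EuclideanSpace ℝ (Fin d) → ℝ)
    (hf : Continuous (Function.uncurry f))
    (hgrowth : ∀ y z, |f y z| ≤ g + K * (|y| + ‖z‖))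
    {n : ℝ} (hn : K ≤ n) :
    ∀ (y : ℝ) (z : EuclideanSpace ℝ (Fin d)),
      |infConv f n y z| ≤ g + K * (|y| + ‖z‖) := by
  intro y z
  have lower : ∀ x ∈ {x : ℝ | ∃ u v, x = f u v + n * (|y - u| + ‖z - v‖)},
      -(g + K * (|y| + ‖z‖)) ≤ x := by
    rintro x ⟨u, v, rfl⟩
    have hfuv := (abs_le.mp (hgrowth u v)).1
    have hu : |u| ≤ |y| + |y - u| := by
      simpa using abs_sub y (y - u)
    have hv : ‖v‖ ≤ ‖z‖ + ‖z - v‖ := by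
      simpa using norm_sub_le z (z - v)
    have hKn : K * (|y - u| + ‖z - v‖) ≤ n * (|y - u| + ‖z - v‖) := by gcongr
    have hKuv : K * (|u| + ‖v‖) ≤ K * ((|y| + |y - u|) + (‖z‖ + ‖z - v‖)) := by gcongr
    linarith
  have hmem : f y z ∈ {x : ℝ | ∃ u v, x = f u v + n * (|y - u| + ‖z - v‖)} :=
    ⟨y, z, by simp⟩
  exact abs_le.mpr ⟨le_csInf ⟨_, hmem⟩ lower,
    (csInf_le ⟨_, lower⟩ hmem).trans (abs_le.mp (hgrowth y z)).2⟩
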